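/- Exact Toeplitz wave expansion in ascending Bessel index (Corollary 1 with R → ∞): let N be an odd positive integer, h = 1/(N+1), u_0 ∈ ℝ^N, and j a positive integer. Define the Toeplitz wave T(j) = Σ_{k=1}^N cos(2j sin(kπ/(2(N+1)))) T_k u_0. Then all infinite series below converge absolutely and T(j) = Σ_{l=0}^{N−1} J_{2l}(2j) ν_l + Σ_{ρ=1}^∞ ( Σ_{l=0}^{N−1} J_{4(N+1)ρ−2l}(2j) ν_l + Σ_{l=0}^{N−1} J_{4(N+1)ρ+2l}(2j) ν_l ) − (1/(2(N+1))) ( α e + β cos(2j) w ), where α = e·u_0 and β = w·u_0. -/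

import Mathlib

open Real Matrix

/-- Bessel function of the first kind of nonnegative integer order n:
J_n(t) = Σ_{m=0}^∞ ((−1)^m/(m!(n+m)!)) (t/2)^{n+2m}. -/
noncomputable def besselJ (n : ℕ) (t : ℝ) : ℝ :=
  ∑' m : ℕ, ((-1 : ℝ) ^ m / ((m.factorial : ℝ) * ((n + m).factorial : ℝ))) * (t / 2) ^ (n + 2 * m)

/-- Toeplitz part: (T_k)_{m,n} = h cos((m−n) k π h), h = 1/(N+1), 1-based k. -/
noncomputable def Tmat (N : ℕ) (k : Fin N) : Matrix (Fin N) (Fin N) ℝ :=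
  fun m n => (1 / (N + 1)) * Real.cos (((m.1 : ℝ) - (n.1 : ℝ)) * (k.1 + 1) * π / (N + 1))

/-- The Toeplitz wave at time t = j Δt (with Δt = Δx):
T(j) = Σ_{k=1}^N cos(2j sin(kπ/(2(N+1)))) T_k u_0. -/
noncomputable def Twave (N : ℕ) (u0 : Fin N → ℝ) (j : ℕ) : Fin N → ℝ :=
  ∑ k : Fin N,
    Real.cos (2 * (j : ℝ) * Real.sin ((k.1 + 1) * π / (2 * (N + 1)))) • (Tmat N k).mulVec u0

/-- ν_0 = u_0 and, for l ≥ 1, (ν_l)_m = Σ_{n : |m−n| = l} (u_0)_n. -/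
def nuvec (N : ℕ) (u0 : Fin N → ℝ) (l : ℕ) : Fin N → ℝ :=
  fun m => ∑ n : Fin N, if m.1 + l = n.1 ∨ n.1 + l = m.1 then u0 n else 0

/-- e = (1,…,1)ᵀ. -/
def evec (N : ℕ) : Fin N → ℝ := fun _ => 1

/-- w_m = (−1)^{m+1} for 1-based m, i.e. (−1)^{m.1}. -/
def wvec (N : ℕ) : Fin N → ℝ := fun m => (-1 : ℝ) ^ m.1


lemma hasSum_congr_aux {ι A : Type*} [AddCommMonoid A] [TopologicalSpace A] {f g : ι → A} {a b : A}
    (h : HasSum f a) (hfg : ∀ i, g i = f i) (hab : b = a) : HasSum g b := by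
  rw [hab, show g = f from funext hfg]
  exact h

/-- The bijection used to reindex the product of exponential series. -/
def idxEquiv : ℤ × ℕ ≃ ℕ × ℕ where
  toFun q := (q.1.toNat + q.2, (-q.1).toNat + q.2)
  invFun r := ((r.1 : ℤ) - r.2, min r.1 r.2)
  left_inv := by
    rintro ⟨n, m⟩
    ext <;> simp <;> omega
  right_inv := by
    rintro ⟨a, b⟩
    ext <;> simp <;> omega

lemma gen_term (t : ℝ) (z : ℂ) (hz : z ≠ 0) (n : ℤ) (m : ℕ) :
    ((-1 : ℂ) ^ ((-n).toNat) * z ^ n) *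
      ((((-1 : ℝ) ^ m / ((m.factorial : ℝ) * ((n.natAbs + m).factorial : ℝ))) *
        (t / 2) ^ (n.natAbs + 2 * m) : ℝ) : ℂ) =
    ((t / 2 : ℂ) * z) ^ (n.toNat + m) / ((n.toNat + m).factorial : ℂ) *
      ((-(t / 2 : ℂ) * z⁻¹) ^ ((-n).toNat + m) / (((-n).toNat + m).factorial : ℂ)) := by
  have hm : (m.factorial : ℂ) ≠ 0 := by exact_mod_cast m.factorial_ne_zero
  push_cast
  generalize (t / 2 : ℂ) = x
  have hx : -x * z⁻¹ = (-1) * x * z⁻¹ := by ring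
  rw [hx]
  simp only [mul_pow, inv_pow]
  rcases Int.eq_nat_or_neg n with ⟨k, rfl | rfl⟩
  · have hk : ((k + m).factorial : ℂ) ≠ 0 := by exact_mod_cast (k + m).factorial_ne_zero
    have e : (-(k : ℤ)).toNat = 0 := by omega
    rw [e, Int.natAbs_natCast, Int.toNat_natCast, zpow_natCast, zero_add]
    generalize ((k + m).factorial : ℂ) = A at *
    generalize (m.factorial : ℂ) = B at *
    field_simp
    ring
  · have hk : ((k + m).factorial : ℂ) ≠ 0 := by exact_mod_cast (k + m).factorial_ne_zero
    have e : (-(k : ℤ)).toNat = 0 := by omega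
    rw [e, neg_neg, Int.natAbs_neg, Int.natAbs_natCast, Int.toNat_natCast, _root_.zpow_neg,
      zpow_natCast, zero_add]
    generalize ((k + m).factorial : ℂ) = A at *
    generalize (m.factorial : ℂ) = B at *
    field_simp
    ring

lemma exp_hasSum (w : ℂ) :
    HasSum (fun n : ℕ => w ^ n / (n.factorial : ℂ)) (Complex.exp w) := by
  rw [Complex.exp_eq_exp_ℂ]
  exact NormedSpace.expSeries_div_hasSum_exp w

lemma exp_mul_hasSum (w v : ℂ) :
    HasSum (fun q : ℤ × ℕ => w ^ (q.1.toNat + q.2) / ((q.1.toNat + q.2).factorial : ℂ) *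
        (v ^ ((-q.1).toNat + q.2) / (((-q.1).toNat + q.2).factorial : ℂ)))
      (Complex.exp w * Complex.exp v) := by
  have hw : Summable (fun n : ℕ => ‖w ^ n / (n.factorial : ℂ)‖) := (exp_hasSum w).summable.norm
  have hv : Summable (fun n : ℕ => ‖v ^ n / (n.factorial : ℂ)‖) := (exp_hasSum v).summable.norm
  have hs : Summable (fun x : ℕ × ℕ => w ^ x.1 / (x.1.factorial : ℂ) *
      (v ^ x.2 / (x.2.factorial : ℂ))) :=
    summable_mul_of_summable_norm (f := fun n : ℕ => w ^ n / (n.factorial : ℂ))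
      (g := fun n : ℕ => v ^ n / (n.factorial : ℂ)) hw hv
  have h2 := HasSum.mul (exp_hasSum w) (exp_hasSum v) hs
  rw [← idxEquiv.hasSum_iff] at h2
  exact hasSum_congr_aux h2 (fun q => rfl) rfl

lemma gen_hasSum (t : ℝ) (z : ℂ) (hz : z ≠ 0) :
    HasSum (fun n : ℤ => (-1 : ℂ) ^ ((-n).toNat) * z ^ n * ((besselJ n.natAbs t : ℝ) : ℂ))
      (Complex.exp ((t / 2 : ℂ) * z) * Complex.exp (-(t / 2 : ℂ) * z⁻¹)) := by
  have h3 := hasSum_congr_aux (exp_mul_hasSum ((t / 2 : ℂ) * z) (-(t / 2 : ℂ) * z⁻¹))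
    (fun q => gen_term t z hz q.1 q.2) rfl
  refine HasSum.prod_fiberwise h3 fun n => ?_
  have h4 := (h3.summable.prod_factor n).hasSum
  simp only at h4
  rw [tsum_mul_left, ← Complex.ofReal_tsum] at h4
  unfold besselJ
  exact h4

lemma cos_hasSum (t θ : ℝ) :
    HasSum (fun p : ℤ => Complex.exp (2 * θ * Complex.I) ^ p *
        ((besselJ (2 * p.natAbs) t : ℝ) : ℂ))
      ((Real.cos (t * Real.sin θ) : ℝ) : ℂ) := by
  set z := Complex.exp (θ * Complex.I) with hz
  have hz0 : z ≠ 0 := Complex.exp_ne_zero _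
  have hzi : z⁻¹ = Complex.exp (-(θ * Complex.I)) := by rw [Complex.exp_neg]
  have h := ((gen_hasSum t z hz0).add (gen_hasSum t (-z) (neg_ne_zero.2 hz0))).div_const 2
  have hv : (Complex.exp ((t / 2 : ℂ) * z) * Complex.exp (-(t / 2 : ℂ) * z⁻¹) +
      Complex.exp ((t / 2 : ℂ) * -z) * Complex.exp (-(t / 2 : ℂ) * (-z)⁻¹)) / 2 =
      ((Real.cos (t * Real.sin θ) : ℝ) : ℂ) := by
    rw [← Complex.exp_add, ← Complex.exp_add, inv_neg, hzi]
    push_cast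
    rw [Complex.cos, Complex.sin]
    have hI := Complex.I_mul_I
    congr 3
    · congr 1
      rw [hz]
      simp only [neg_mul]
      linear_combination (-(t:ℂ)/2) * (Complex.exp (-(θ * Complex.I)) - Complex.exp (θ * Complex.I)) * hI
    · rw [hz]
      simp only [neg_mul]
      linear_combination ((t:ℂ)/2) * (Complex.exp (-(θ * Complex.I)) - Complex.exp (θ * Complex.I)) * hI
  rw [hv] at h
  have hinj : Function.Injective (fun p : ℤ => 2 * p) := fun a b hab => by
    simp only at hab; omega
  rw [← hinj.hasSum_iff] at h
  · refine hasSum_congr_aux h (fun p => ?_) rfl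
    have e1 : (2 * p).natAbs = 2 * p.natAbs := by omega
    have e2 : (-1 : ℂ) ^ ((-(2 * p)).toNat) = 1 := by
      apply Even.neg_one_pow
      exact ⟨(-p).toNat, by omega⟩
    have e3 : Complex.exp (2 * θ * Complex.I) = z ^ (2:ℤ) := by
      rw [hz, ← Complex.exp_int_mul]; congr 1; push_cast; ring
    have e4 : (-z) ^ (2 * p) = z ^ (2 * p) := (even_two_mul p).neg_zpow z
    simp only [Function.comp]
    rw [e1, e2, e3, e4, ← _root_.zpow_mul]
    ring
  · intro n hn
    have : Odd n := by
      rw [← Int.not_even_iff_odd]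
      rintro ⟨r, hr⟩
      exact hn ⟨r, by simp only; omega⟩
    rw [this.neg_zpow]
    ring

lemma root_sum (K : ℕ) (hK : 0 < K) (n : ℤ) :
    ∑ k ∈ Finset.range K, (Complex.exp (2 * π * Complex.I / K) ^ n) ^ k =
      if (K : ℤ) ∣ n then (K : ℂ) else 0 := by
  have hp := Complex.isPrimitiveRoot_exp K hK.ne'
  split_ifs with h
  · rw [(hp.zpow_eq_one_iff_dvd n).2 h]; simp
  · have h1 : Complex.exp (2 * π * Complex.I / K) ^ n ≠ 1 := fun h' =>
      h ((hp.zpow_eq_one_iff_dvd n).1 h')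
    rw [geom_sum_eq h1]
    rw [← zpow_natCast, ← _root_.zpow_mul, mul_comm n, _root_.zpow_mul, zpow_natCast, hp.pow_eq_one]
    simp

lemma alias_hasSum (M : ℕ) (hM : 0 < M) (t : ℝ) (d : ℤ) :
    HasSum (fun r : ℤ => besselJ (2 * (d + 2 * M * r).natAbs) t)
      ((1 / (2 * M)) * ∑ k ∈ Finset.range (2 * M),
        Real.cos (t * Real.sin (k * π / (2 * M))) * Real.cos (d * k * π / M)) := by
  have hMc : (M : ℂ) ≠ 0 := by exact_mod_cast hM.ne'
  set ζ := Complex.exp (2 * π * Complex.I / (2 * M : ℕ)) with hζ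
  have hζ0 : ζ ≠ 0 := Complex.exp_ne_zero _
  have h1 : HasSum (fun p : ℤ => ∑ k ∈ Finset.range (2 * M),
      (ζ ^ (-d)) ^ k * (Complex.exp (2 * ((k * π / (2 * M) : ℝ) : ℂ) * Complex.I) ^ p *
        ((besselJ (2 * p.natAbs) t : ℝ) : ℂ))) _ :=
    hasSum_sum fun k _ => (cos_hasSum t (k * π / (2 * M))).mul_left ((ζ ^ (-d)) ^ k)
  have hterm : ∀ p : ℤ, ∑ k ∈ Finset.range (2 * M),
      (ζ ^ (-d)) ^ k * (Complex.exp (2 * ((k * π / (2 * M) : ℝ) : ℂ) * Complex.I) ^ p *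
        ((besselJ (2 * p.natAbs) t : ℝ) : ℂ)) =
      (if ((2 * M : ℕ) : ℤ) ∣ p - d then ((2 * M : ℕ) : ℂ) else 0) *
        ((besselJ (2 * p.natAbs) t : ℝ) : ℂ) := by
    intro p
    rw [← root_sum (2 * M) (by omega) (p - d), Finset.sum_mul]
    refine Finset.sum_congr rfl fun k _ => ?_
    have e : Complex.exp (2 * ((k * π / (2 * M) : ℝ) : ℂ) * Complex.I) = ζ ^ k := by
      rw [hζ, ← Complex.exp_nat_mul]; congr 1; push_cast; field_simp
    rw [e, ← hζ, sub_eq_add_neg, zpow_add₀ hζ0, mul_pow, ← mul_assoc]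
    congr 1
    rw [mul_comm, ← zpow_natCast ζ k, ← zpow_natCast (ζ ^ p) k, ← _root_.zpow_mul, ← _root_.zpow_mul,
      mul_comm p]
  simp only [hterm] at h1
  have hinj : Function.Injective (fun r : ℤ => d + 2 * M * r) := fun a b hab => by
    have hM' : (2 * M : ℤ) ≠ 0 := by positivity
    simpa [hM'.symm, hM.ne'] using hab
  rw [← hinj.hasSum_iff] at h1
  · have h2 := Complex.hasSum_re (h1.mul_left (1 / (2 * M : ℂ)))
    refine hasSum_congr_aux h2 (fun r => ?_) ?_
    · simp only [Function.comp]
      rw [if_pos ⟨r, by push_cast; ring⟩, ← mul_assoc]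
      have : (1 / (2 * M : ℂ)) * ((2 * M : ℕ) : ℂ) = 1 := by push_cast; field_simp
      rw [this, one_mul, Complex.ofReal_re]
    · have : (1 / (2 * M : ℂ)) = ((1 / (2 * M) : ℝ) : ℂ) := by push_cast; rfl
      rw [this, Complex.re_ofReal_mul, Complex.re_sum]
      congr 1
      refine Finset.sum_congr rfl fun k _ => ?_
      rw [Complex.re_mul_ofReal, mul_comm]
      congr 1
      have e : (ζ ^ (-d)) ^ k = Complex.exp (((-(d * k * π / M) : ℝ) : ℂ) * Complex.I) := by
        rw [hζ, ← Complex.exp_int_mul, ← Complex.exp_nat_mul]; congr 1; push_cast; field_simp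
      rw [e, Complex.exp_ofReal_mul_I_re, Real.cos_neg]
  · intro p hp
    rw [if_neg, zero_mul]
    rintro ⟨r, hr⟩
    exact hp ⟨r, by simp only; push_cast at hr; linarith⟩

lemma fold_sum (N : ℕ) (t : ℝ) (d : ℤ) :
    ∑ k ∈ Finset.range (2 * (N + 1)),
        Real.cos (t * Real.sin (k * π / (2 * (N + 1)))) * Real.cos (d * k * π / (N + 1)) =
      1 + (-1) ^ d * Real.cos t + 2 * ∑ k : Fin N,
        Real.cos (t * Real.sin ((k.1 + 1) * π / (2 * (N + 1)))) *
          Real.cos (d * (k.1 + 1) * π / (N + 1)) := by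
  set f : ℕ → ℝ := fun k => Real.cos (t * Real.sin (k * π / (2 * (N + 1)))) *
    Real.cos (d * k * π / (N + 1)) with hf
  have hN0 : (N : ℝ) + 1 ≠ 0 := by positivity
  have h0 : f 0 = 1 := by simp [hf]
  have hM : f (N + 1) = (-1) ^ d * Real.cos t := by
    simp only [hf]; push_cast
    have e1 : ((N : ℝ) + 1) * π / (2 * (N + 1)) = π / 2 := by field_simp
    have e2 : (d : ℝ) * (N + 1) * π / (N + 1) = d * π := by field_simp
    rw [e1, e2, Real.sin_pi_div_two, Real.cos_int_mul_pi, mul_one, mul_comm]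
  have hrefl : ∀ k ∈ Finset.range N, f (N + 1 + (k + 1)) = f (N - 1 - k + 1) := by
    intro k hk
    have hk' : k < N := Finset.mem_range.1 hk
    have : ((N - 1 - k + 1 : ℕ) : ℝ) = N - k := by
      rw [show N - 1 - k + 1 = N - k by omega, Nat.cast_sub hk'.le]
    simp only [hf, this]; push_cast
    have e1 : ((N : ℝ) + 1 + (k + 1)) * π / (2 * (N + 1)) = π - (N - k) * π / (2 * (N + 1)) := by
      field_simp; ring
    have e2 : (d : ℝ) * (N + 1 + (k + 1)) * π / (N + 1) =
        d * (2 * π) - d * (N - k) * π / (N + 1) := by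
      field_simp; ring
    rw [e1, e2, Real.sin_pi_sub, Real.cos_int_mul_two_pi_sub]
  have hfin : ∑ k : Fin N, Real.cos (t * Real.sin ((k.1 + 1) * π / (2 * (N + 1)))) *
          Real.cos (d * (k.1 + 1) * π / (N + 1)) = ∑ k ∈ Finset.range N, f (k + 1) := by
    rw [← Fin.sum_univ_eq_sum_range (fun k => f (k + 1))]
    simp [hf]
  rw [hfin, show 2 * (N + 1) = (N + 1) + (N + 1) by ring, Finset.sum_range_add,
    Finset.sum_range_succ' f, Finset.sum_range_succ' (fun x => f (N + 1 + x)),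
    Finset.sum_congr rfl hrefl, Finset.sum_range_reflect (fun k => f (k + 1)), add_zero, h0, hM]
  ring

lemma key_hasSum (N : ℕ) (t : ℝ) (l : ℕ) (hl : l < N) :
    HasSum (fun ρ : ℕ => besselJ (4 * (N + 1) * (ρ + 1) - 2 * l) t +
        besselJ (4 * (N + 1) * (ρ + 1) + 2 * l) t)
      ((1 / (N + 1)) * (∑ k : Fin N,
        Real.cos (t * Real.sin ((k.1 + 1) * π / (2 * (N + 1)))) *
          Real.cos (l * (k.1 + 1) * π / (N + 1)))
        + (1 / (2 * (N + 1))) * (1 + (-1) ^ l * Real.cos t) - besselJ (2 * l) t) ∧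
    Summable (fun ρ : ℕ => |besselJ (4 * (N + 1) * (ρ + 1) - 2 * l) t|) ∧
    Summable (fun ρ : ℕ => |besselJ (4 * (N + 1) * (ρ + 1) + 2 * l) t|) := by
  have h := alias_hasSum (N + 1) N.succ_pos t (l : ℤ)
  have hf := fold_sum N t (l : ℤ)
  push_cast at h hf
  rw [hf] at h
  have e1 : ∀ ρ : ℕ, 2 * ((l : ℤ) + 2 * (N + 1) * (-((ρ : ℤ) + 1))).natAbs =
      4 * (N + 1) * (ρ + 1) - 2 * l := by
    intro ρ
    have hle : l ≤ 2 * (N + 1) * (ρ + 1) := by nlinarith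
    have : (l : ℤ) + 2 * (N + 1) * (-((ρ : ℤ) + 1)) = l - ((2 * (N + 1) * (ρ + 1) : ℕ) : ℤ) := by
      push_cast; ring
    rw [this, show 4 * (N + 1) * (ρ + 1) = 2 * (2 * (N + 1) * (ρ + 1)) by ring]
    omega
  have e2 : ∀ ρ : ℕ, 2 * ((l : ℤ) + 2 * (N + 1) * ((ρ : ℤ) + 1)).natAbs =
      4 * (N + 1) * (ρ + 1) + 2 * l := by
    intro ρ
    have : (l : ℤ) + 2 * (N + 1) * ((ρ : ℤ) + 1) = ((l + 2 * (N + 1) * (ρ + 1) : ℕ) : ℤ) := by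
      push_cast; ring
    rw [this, Int.natAbs_natCast]; ring
  have s1 : Summable (fun ρ : ℕ => besselJ (4 * (N + 1) * (ρ + 1) - 2 * l) t) := by
    have := h.summable.comp_injective
      (i := fun ρ : ℕ => -((ρ : ℤ) + 1)) (fun a b hab => by simp only at hab; omega)
    simpa only [Function.comp_def, e1] using this
  have s2 : Summable (fun ρ : ℕ => besselJ (4 * (N + 1) * (ρ + 1) + 2 * l) t) := by
    have := h.summable.comp_injective
      (i := fun ρ : ℕ => ((ρ : ℤ) + 1)) (fun a b hab => by simp only at hab; omega)
    simpa only [Function.comp_def, e2] using this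
  refine ⟨?_, s1.abs, s2.abs⟩
  have h3 := h.nat_add_neg
  rw [← hasSum_nat_add_iff' 1] at h3
  simp only [Finset.sum_range_one] at h3
  push_cast at h3
  simp only [e1, e2] at h3
  refine hasSum_congr_aux h3 (fun ρ => by ring) ?_
  · simp only [mul_zero, neg_zero, add_zero, Int.natAbs_natCast, zpow_natCast]
    generalize (∑ k : Fin N, Real.cos (t * Real.sin ((k.1 + 1) * π / (2 * (N + 1)))) *
          Real.cos (l * (k.1 + 1) * π / (N + 1))) = S
    field_simp
    ring

lemma nu_sum (N : ℕ) (u0 : Fin N → ℝ) (c : ℕ → ℝ) (m : Fin N) :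
    (∑ l ∈ Finset.range N, c l • nuvec N u0 l) m =
      ∑ n : Fin N, c ((m.1 : ℤ) - n.1).natAbs * u0 n := by
  simp only [Finset.sum_apply, Pi.smul_apply, smul_eq_mul, nuvec, Finset.mul_sum]
  rw [Finset.sum_comm]
  refine Finset.sum_congr rfl fun n _ => ?_
  have hm := m.2
  have hn := n.2
  rw [Finset.sum_eq_single ((m.1 : ℤ) - n.1).natAbs]
  · rw [if_pos (by omega)]
  · intro b _ hb
    rw [if_neg (by omega), mul_zero]
  · intro h
    exact absurd (Finset.mem_range.2 (by omega)) h

/-- Exact Toeplitz wave expansion in ascending Bessel index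
(Corollary 1 with R → ∞): for odd positive N and integer j ≥ 1, all Bessel
series converge absolutely and
T(j) = Σ_{l=0}^{N−1} J_{2l}(2j) ν_l
  + Σ_{ρ≥1} (Σ_{l=0}^{N−1} J_{4(N+1)ρ−2l}(2j) ν_l + Σ_{l=0}^{N−1} J_{4(N+1)ρ+2l}(2j) ν_l)
  − (1/(2(N+1)))(α e + β cos(2j) w), with α = e·u_0, β = w·u_0. -/
theorem stmt17 (N : ℕ) (hN : 0 < N) (hNodd : Odd N) (u0 : Fin N → ℝ)
    (j : ℕ) (hj : 1 ≤ j) :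
    (∀ l : ℕ, l ≤ N - 1 →
      Summable (fun ρ : ℕ => |besselJ (4 * (N + 1) * (ρ + 1) - 2 * l) (2 * (j : ℝ))|) ∧
      Summable (fun ρ : ℕ => |besselJ (4 * (N + 1) * (ρ + 1) + 2 * l) (2 * (j : ℝ))|)) ∧
    Twave N u0 j =
      (∑ l ∈ Finset.range N, besselJ (2 * l) (2 * (j : ℝ)) • nuvec N u0 l)
      + (∑' ρ : ℕ,
          ((∑ l ∈ Finset.range N,
              besselJ (4 * (N + 1) * (ρ + 1) - 2 * l) (2 * (j : ℝ)) • nuvec N u0 l)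
            + ∑ l ∈ Finset.range N,
                besselJ (4 * (N + 1) * (ρ + 1) + 2 * l) (2 * (j : ℝ)) • nuvec N u0 l))
      - (1 / (2 * ((N : ℝ) + 1)))
          • ((evec N ⬝ᵥ u0) • evec N + ((wvec N ⬝ᵥ u0) * Real.cos (2 * (j : ℝ))) • wvec N) := by
  have hlt : ∀ m n : Fin N, ((m.1 : ℤ) - n.1).natAbs < N := fun m n => by
    have := m.2
    have := n.2
    omega
  refine ⟨fun l hl => (key_hasSum N (2 * (j : ℝ)) l (by omega)).2, ?_⟩
  have hs : HasSum (fun ρ : ℕ => ((∑ l ∈ Finset.range N,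
              besselJ (4 * (N + 1) * (ρ + 1) - 2 * l) (2 * (j : ℝ)) • nuvec N u0 l)
            + ∑ l ∈ Finset.range N,
                besselJ (4 * (N + 1) * (ρ + 1) + 2 * l) (2 * (j : ℝ)) • nuvec N u0 l))
      (Twave N u0 j - (∑ l ∈ Finset.range N, besselJ (2 * l) (2 * (j : ℝ)) • nuvec N u0 l)
      + (1 / (2 * ((N : ℝ) + 1)))
          • ((evec N ⬝ᵥ u0) • evec N + ((wvec N ⬝ᵥ u0) * Real.cos (2 * (j : ℝ))) • wvec N)) := by
    rw [Pi.hasSum]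
    intro m
    have h := hasSum_sum (s := Finset.univ) fun (n : Fin N) _ =>
      ((key_hasSum N (2 * (j : ℝ)) _ (hlt m n)).1.mul_right (u0 n))
    refine hasSum_congr_aux h (fun ρ => ?_) ?_
    · rw [Pi.add_apply, nu_sum N u0 (fun l => besselJ (4 * (N + 1) * (ρ + 1) - 2 * l) (2 * (j : ℝ))),
        nu_sum N u0 (fun l => besselJ (4 * (N + 1) * (ρ + 1) + 2 * l) (2 * (j : ℝ))),
        ← Finset.sum_add_distrib]
      exact Finset.sum_congr rfl fun n _ => by ring
    · rw [Pi.add_apply, Pi.sub_apply,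
        nu_sum N u0 (fun l => besselJ (2 * l) (2 * (j : ℝ)))]
      have hT : Twave N u0 j m = ∑ n : Fin N, (1 / (N + 1)) * (∑ k : Fin N,
        Real.cos (2 * (j : ℝ) * Real.sin ((k.1 + 1) * π / (2 * (N + 1)))) *
          Real.cos (((m.1 : ℤ) - n.1).natAbs * (k.1 + 1) * π / (N + 1))) * u0 n := by
        simp only [Twave, Finset.sum_apply, Pi.smul_apply, smul_eq_mul, Matrix.mulVec,
          dotProduct, Tmat, Finset.mul_sum, Finset.sum_mul]
        rw [Finset.sum_comm]
        refine Finset.sum_congr rfl fun n _ => Finset.sum_congr rfl fun k _ => ?_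
        have : Real.cos ((((m.1 : ℤ) - n.1).natAbs : ℝ) * (k.1 + 1) * π / (N + 1)) =
            Real.cos (((m.1 : ℝ) - (n.1 : ℝ)) * (k.1 + 1) * π / (N + 1)) := by
          rw [Nat.cast_natAbs]
          push_cast
          rcases abs_choice ((m.1 : ℝ) - (n.1 : ℝ)) with h | h <;> rw [h]
          rw [← Real.cos_neg]
          congr 1
          ring
        rw [this]
        ring
      have hE : ((1 / (2 * ((N : ℝ) + 1)))
          • ((evec N ⬝ᵥ u0) • evec N + ((wvec N ⬝ᵥ u0) * Real.cos (2 * (j : ℝ))) • wvec N)) m =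
          ∑ n : Fin N, (1 / (2 * ((N : ℝ) + 1))) *
            (1 + (-1) ^ ((m.1 : ℤ) - n.1).natAbs * Real.cos (2 * (j : ℝ))) * u0 n := by
        simp only [Pi.smul_apply, Pi.add_apply, smul_eq_mul, evec, wvec, dotProduct,
          mul_add, add_mul, Finset.sum_add_distrib, Finset.mul_sum, Finset.sum_mul]
        congr 1
        · exact Finset.sum_congr rfl fun n _ => by ring
        · refine Finset.sum_congr rfl fun n _ => ?_
          have : (-1 : ℝ) ^ ((m.1 : ℤ) - n.1).natAbs = (-1) ^ m.1 * (-1) ^ n.1 := by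
            rw [← pow_add]
            apply neg_one_pow_congr
            rw [Nat.even_iff, Nat.even_iff]
            omega
          rw [this]
          ring
      rw [hT, hE, ← Finset.sum_sub_distrib, ← Finset.sum_add_distrib]
      exact Finset.sum_congr rfl fun n _ => by ring
  rw [hs.tsum_eq]
  abel
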